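/- The double integral ∫_{ℝ^d} ∫_{ℝ^d} T₂(x,y)² dN(m₀,Σ₀)(x) dN(m₀,Σ₀)(y) equals det(V)^{−1/2} det(V + 4σΣ₀)^{−1/2} · { 1 + (1/2)σ²(tr[V^{−1}Σ₀])² + σ² tr[(V^{−1}Σ₀)²] + (1/2)σ²(tr[(V + 4σΣ₀)^{−1}Σ₀])² + σ² tr[((V + 4σΣ₀)^{−1}Σ₀)²] + σ tr[V^{−1}Σ₀] − σ tr[(V + 4σΣ₀)^{−1}Σ₀] − σ² tr[V^{−1}Σ₀] tr[(V + 4σΣ₀)^{−1}Σ₀] }. -/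

import Mathlib

open MeasureTheory Matrix Real

/-- The Gaussian probability measure `N(m, Σ)` on `ℝ^d`, given by its density
`(2π)^{-d/2} det(Σ)^{-1/2} exp(-(x-m)ᵀ Σ⁻¹ (x-m) / 2)` with respect to Lebesgue measure. -/
noncomputable def gaussN {d : ℕ} (m : Fin d → ℝ) (S : Matrix (Fin d) (Fin d) ℝ) :
    Measure (Fin d → ℝ) :=
  MeasureTheory.volume.withDensity fun x =>
    ENNReal.ofReal ((2 * π) ^ (-(d : ℝ) / 2) * S.det ^ (-(1 : ℝ) / 2) *
      Real.exp (-((x - m) ⬝ᵥ (S⁻¹ *ᵥ (x - m))) / 2))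

/-- `V = I_d + 2σΣ₀`. -/
noncomputable def Vm {d : ℕ} (σ : ℝ) (S : Matrix (Fin d) (Fin d) ℝ) :
    Matrix (Fin d) (Fin d) ℝ :=
  1 + (2 * σ) • S

/-- `B(x) = (x−m₀)(x−m₀)ᵀ − Σ₀`. -/
noncomputable def Bm {d : ℕ} (m₀ : Fin d → ℝ) (S : Matrix (Fin d) (Fin d) ℝ)
    (x : Fin d → ℝ) : Matrix (Fin d) (Fin d) ℝ :=
  vecMulVec (x - m₀) (x - m₀) - S

/-- `T₁(x,y) = exp(−σ‖x−y‖²)`. -/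
noncomputable def T1 {d : ℕ} (σ : ℝ) (x y : Fin d → ℝ) : ℝ :=
  Real.exp (-σ * ((x - y) ⬝ᵥ (x - y)))

/-- `T₂(x,y) = det(V)^{−1/2} exp(−σ(x−m₀)ᵀV⁻¹(x−m₀)) ·
(1 + 2σ(x−m₀)ᵀV⁻¹(y−m₀) + σ tr[V⁻¹(2σ(B(x)+Σ₀)V⁻¹ − I_d)B(y)])`. -/
noncomputable def T2 {d : ℕ} (σ : ℝ) (m₀ : Fin d → ℝ) (S : Matrix (Fin d) (Fin d) ℝ)
    (x y : Fin d → ℝ) : ℝ :=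
  (Vm σ S).det ^ (-(1 : ℝ) / 2) *
    Real.exp (-σ * ((x - m₀) ⬝ᵥ ((Vm σ S)⁻¹ *ᵥ (x - m₀)))) *
    (1 + 2 * σ * ((x - m₀) ⬝ᵥ ((Vm σ S)⁻¹ *ᵥ (y - m₀))) +
      σ * ((Vm σ S)⁻¹ * ((2 * σ) • (Bm m₀ S x + S) * (Vm σ S)⁻¹ - 1) * Bm m₀ S y).trace)

/-- `T₃(x,y) = T₂(y,x)`. -/
noncomputable def T3 {d : ℕ} (σ : ℝ) (m₀ : Fin d → ℝ) (S : Matrix (Fin d) (Fin d) ℝ)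
    (x y : Fin d → ℝ) : ℝ :=
  T2 σ m₀ S y x

/-- `T₄(x,y) = det(2V−I_d)^{−1/2} · (1 + σ tr[(2(x−m₀)(y−m₀)ᵀ − B(x) − B(y))(2V−I_d)⁻¹]
+ σ²(tr[B(x)(2V−I_d)⁻¹]·tr[B(y)(2V−I_d)⁻¹] + 2 tr[B(x)(2V−I_d)⁻¹B(y)(2V−I_d)⁻¹]))`. -/
noncomputable def T4 {d : ℕ} (σ : ℝ) (m₀ : Fin d → ℝ) (S : Matrix (Fin d) (Fin d) ℝ)
    (x y : Fin d → ℝ) : ℝ :=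
  ((2 : ℝ) • Vm σ S - 1).det ^ (-(1 : ℝ) / 2) *
    (1 + σ * (((2 : ℝ) • vecMulVec (x - m₀) (y - m₀) - Bm m₀ S x - Bm m₀ S y) *
        ((2 : ℝ) • Vm σ S - 1)⁻¹).trace +
      σ ^ 2 * ((Bm m₀ S x * ((2 : ℝ) • Vm σ S - 1)⁻¹).trace *
          (Bm m₀ S y * ((2 : ℝ) • Vm σ S - 1)⁻¹).trace +
        2 * (Bm m₀ S x * ((2 : ℝ) • Vm σ S - 1)⁻¹ *
          Bm m₀ S y * ((2 : ℝ) • Vm σ S - 1)⁻¹).trace))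

/-- `K(x,y) = T₁(x,y) − T₂(x,y) − T₃(x,y) + T₄(x,y)`. -/
noncomputable def Kf {d : ℕ} (σ : ℝ) (m₀ : Fin d → ℝ) (S : Matrix (Fin d) (Fin d) ℝ)
    (x y : Fin d → ℝ) : ℝ :=
  T1 σ x y - T2 σ m₀ S x y - T3 σ m₀ S x y + T4 σ m₀ S x y

open ProbabilityTheory
open scoped NNReal ENNReal

section AllMoments

variable {Ω : Type*} [MeasurableSpace Ω] {μ : Measure Ω}

/-- A real function all of whose finite moments exist. -/
def HasAllMoments (f : Ω → ℝ) (μ : Measure Ω) : Prop :=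
  ∀ p : ℝ≥0∞, p ≠ ⊤ → MemLp f p μ

namespace HasAllMoments

lemma add {f g : Ω → ℝ} (hf : HasAllMoments f μ) (hg : HasAllMoments g μ) :
    HasAllMoments (fun x => f x + g x) μ :=
  fun p hp => (hf p hp).add (hg p hp)

lemma mul {f g : Ω → ℝ} (hf : HasAllMoments f μ) (hg : HasAllMoments g μ) :
    HasAllMoments (fun x => f x * g x) μ := by
  intro p hp
  have hp2 : p * 2 ≠ ⊤ := ENNReal.mul_ne_top hp (by simp)
  have : ENNReal.HolderTriple (p * 2) (p * 2) p := by
    constructor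
    rw [ENNReal.mul_inv (Or.inr (by simp)) (Or.inr (by simp)), ← mul_add,
      ENNReal.inv_two_add_inv_two, mul_one]
  exact (hg _ hp2).mul (hf _ hp2)

lemma of_bound [IsFiniteMeasure μ] {f : Ω → ℝ} (hf : AEStronglyMeasurable f μ) (C : ℝ)
    (h : ∀ x, ‖f x‖ ≤ C) : HasAllMoments f μ :=
  fun _ _ => MemLp.of_bound hf C (ae_of_all _ h)

lemma const [IsFiniteMeasure μ] (c : ℝ) : HasAllMoments (fun _ : Ω => c) μ :=
  fun _ _ => memLp_const c

lemma const_mul {f : Ω → ℝ} (c : ℝ) (hf : HasAllMoments f μ) :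
    HasAllMoments (fun x => c * f x) μ :=
  fun p hp => (hf p hp).const_mul c

lemma sum {ι : Type*} {f : ι → Ω → ℝ} (s : Finset ι) (hf : ∀ i, HasAllMoments (f i) μ) :
    HasAllMoments (fun x => ∑ i ∈ s, f i x) μ :=
  fun p hp => memLp_finsetSum s fun i _ => hf i p hp

lemma pow [IsFiniteMeasure μ] {f : Ω → ℝ} (hf : HasAllMoments f μ) (n : ℕ) :
    HasAllMoments (fun x => f x ^ n) μ := by
  induction n with
  | zero => simpa using const 1
  | succ n ih => simpa only [pow_succ] using ih.mul hf

lemma integrable {f : Ω → ℝ} (hf : HasAllMoments f μ) : Integrable f μ :=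
  memLp_one_iff_integrable.1 (hf 1 (by simp))

lemma comp {Ω' : Type*} [MeasurableSpace Ω'] {ν : Measure Ω'} {f : Ω → ℝ} {g : Ω' → Ω}
    (hf : HasAllMoments f μ) (hg : MeasurePreserving g ν μ) :
    HasAllMoments (fun x => f (g x)) ν :=
  fun p hp => (hf p hp).comp_measurePreserving hg

end HasAllMoments

end AllMoments

section DiagGaussian

variable {ι : Type*} [Fintype ι]

/-- The law of a family of independent centred real Gaussians with variances `v i`. -/
noncomputable def diagGaussian (v : ι → ℝ≥0) : Measure (ι → ℝ) :=
  Measure.pi fun i => gaussianReal 0 (v i)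

instance (v : ι → ℝ≥0) : IsProbabilityMeasure (diagGaussian v) := by
  unfold diagGaussian; infer_instance

lemma hasAllMoments_coord (v : ι → ℝ≥0) (i : ι) :
    HasAllMoments (fun w : ι → ℝ => w i) (diagGaussian v) :=
  HasAllMoments.comp (f := id) (fun p hp => memLp_id_gaussianReal' p hp)
    (measurePreserving_eval (fun i => gaussianReal 0 (v i)) i)

lemma hasAllMoments_linear (v : ι → ℝ≥0) (a : ι → ℝ) :
    HasAllMoments (fun w : ι → ℝ => ∑ i, a i * w i) (diagGaussian v) :=
  HasAllMoments.sum _ fun i => (hasAllMoments_coord v i).const_mul (a i)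

lemma diagGaussian_map_linear (v : ι → ℝ≥0) (a : ι → ℝ) :
    (diagGaussian v).map (fun w => ∑ i, a i * w i) =
      gaussianReal 0 (∑ i, (a i ^ 2).toNNReal * v i) := by
  apply Measure.ext_of_charFun
  ext t
  rw [charFun_gaussianReal, charFun_apply_real,
    integral_map (Measurable.aemeasurable (by fun_prop)) (by fun_prop)]
  have h : ∀ w : ι → ℝ, Complex.exp (t * ((∑ i, a i * w i : ℝ) : ℂ) * Complex.I) =
      ∏ i, Complex.exp (((t * a i : ℝ) : ℂ) * (w i : ℂ) * Complex.I) := by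
    intro w
    rw [← Complex.exp_sum]
    push_cast
    rw [Finset.mul_sum, Finset.sum_mul]
    congr 1
    exact Finset.sum_congr rfl fun i _ => by ring
  simp_rw [h]
  rw [diagGaussian, integral_fintype_prod_eq_prod
    (f := fun i (x : ℝ) => Complex.exp (((t * a i : ℝ) : ℂ) * (x : ℂ) * Complex.I))]
  simp_rw [← charFun_apply_real, charFun_gaussianReal]
  rw [← Complex.exp_sum]
  congr 1
  push_cast
  simp only [Real.coe_toNNReal _ (sq_nonneg _), mul_zero, zero_mul, zero_sub]
  rw [Finset.sum_mul, Finset.sum_div, ← Finset.sum_neg_distrib]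
  refine Finset.sum_congr rfl fun i _ => ?_
  push_cast
  ring

lemma integral_pow_four_gaussianReal (v : ℝ≥0) : ∫ x, x ^ 4 ∂(gaussianReal 0 v) = 3 * v ^ 2 := by
  have h := iteratedDeriv_mgf_zero (X := fun x : ℝ => x) (μ := gaussianReal 0 v) (by simp) 4
  have e : ∀ t : ℝ, HasDerivAt (fun t : ℝ => rexp (v * t ^ 2 / 2))
      (rexp (v * t ^ 2 / 2) * (v * t)) t := fun t => by
    convert (((hasDerivAt_pow 2 t).const_mul (v : ℝ)).div_const 2).exp using 1
    simp
    ring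
  have key : ∀ p p' : ℝ → ℝ, (∀ t, HasDerivAt p (p' t) t) →
      deriv (fun t : ℝ => rexp (v * t ^ 2 / 2) * p t) =
        fun t => rexp (v * t ^ 2 / 2) * (v * t * p t + p' t) :=
    fun p p' hp => funext fun t => ((e t).mul (hp t)).deriv.trans (by ring)
  have e1 : deriv (fun t : ℝ => rexp (v * t ^ 2 / 2)) =
      fun t => rexp (v * t ^ 2 / 2) * (v * t) := funext fun t => (e t).deriv
  have l : ∀ t : ℝ, HasDerivAt (fun t : ℝ => (v : ℝ) * t) v t := fun t => by
    simpa using (hasDerivAt_id t).const_mul (v : ℝ)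
  have l2 : ∀ t : ℝ, HasDerivAt (fun t : ℝ => (v : ℝ) * t * (v * t) + v) (2 * v ^ 2 * t) t :=
    fun t => by
      refine (((l t).mul (l t)).add_const (v : ℝ)).congr_deriv ?_
      ring
  have l3 : ∀ t : ℝ, HasDerivAt
      (fun t : ℝ => (v : ℝ) * t * (v * t * (v * t) + v) + 2 * v ^ 2 * t)
      (3 * v ^ 3 * t ^ 2 + 3 * v ^ 2) t :=
    fun t => by
      refine (((l t).mul (l2 t)).add ((hasDerivAt_id t).const_mul (2 * (v : ℝ) ^ 2))).congr_deriv ?_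
      simp
      ring
  rw [mgf_fun_id_gaussianReal] at h
  simp only [zero_mul, zero_add] at h
  rw [iteratedDeriv_succ, iteratedDeriv_succ, iteratedDeriv_succ, iteratedDeriv_one,
    e1, key _ _ l, key _ _ l2, key _ _ l3] at h
  simpa using h.symm

lemma coe_variance (v : ι → ℝ≥0) (a : ι → ℝ) :
    ((∑ i, (a i ^ 2).toNNReal * v i : ℝ≥0) : ℝ) = ∑ i, v i * a i ^ 2 := by
  push_cast
  exact Finset.sum_congr rfl fun i _ => by rw [Real.coe_toNNReal _ (sq_nonneg _), mul_comm]

lemma integral_linear_pow_two (v : ι → ℝ≥0) (a : ι → ℝ) :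
    ∫ w, (∑ i, a i * w i) ^ 2 ∂(diagGaussian v) = ∑ i, v i * a i ^ 2 := by
  rw [← coe_variance, ← variance_fun_id_gaussianReal (μ := 0), ← diagGaussian_map_linear,
    variance_of_integral_eq_zero (by fun_prop)
      (by rw [diagGaussian_map_linear]; exact integral_id_gaussianReal),
    integral_map (Measurable.aemeasurable (by fun_prop)) (by fun_prop)]

lemma integral_linear_pow_four (v : ι → ℝ≥0) (a : ι → ℝ) :
    ∫ w, (∑ i, a i * w i) ^ 4 ∂(diagGaussian v) = 3 * (∑ i, v i * a i ^ 2) ^ 2 := by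
  rw [← coe_variance, ← integral_pow_four_gaussianReal, ← diagGaussian_map_linear,
    integral_map (Measurable.aemeasurable (by fun_prop)) (by fun_prop)]

lemma integral_eq_zero_of_odd (v : ι → ℝ≥0) (f : (ι → ℝ) → ℝ) (hf : ∀ w, f (-w) = -f w) :
    ∫ w, f w ∂(diagGaussian v) = 0 := by
  have h1 : MeasurePreserving (fun w : ι → ℝ => fun i => -w i) (diagGaussian v)
      (diagGaussian v) :=
    measurePreserving_pi _ _ fun i =>
      ⟨measurable_neg, by simpa using gaussianReal_map_neg (μ := 0) (v := v i)⟩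
  have h2 := h1.integral_comp (Homeomorph.neg (ι → ℝ)).measurableEmbedding f
  have h3 : ∀ w : ι → ℝ, f (fun i => -w i) = -f w := hf
  simp_rw [h3, integral_neg] at h2
  linarith

lemma integral_linear_sq_mul_linear_sq (v : ι → ℝ≥0) (a b : ι → ℝ) :
    ∫ w, (∑ i, a i * w i) ^ 2 * (∑ i, b i * w i) ^ 2 ∂(diagGaussian v) =
      (∑ i, v i * a i ^ 2) * (∑ i, v i * b i ^ 2) + 2 * (∑ i, v i * (a i * b i)) ^ 2 := by
  have hp := integral_linear_pow_four v (a + b)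
  have hm := integral_linear_pow_four v (a - b)
  have ha := integral_linear_pow_four v a
  have hb := integral_linear_pow_four v b
  have ia := hasAllMoments_linear v a
  have ib := hasAllMoments_linear v b
  have h : ∀ w : ι → ℝ, (∑ i, a i * w i) ^ 2 * (∑ i, b i * w i) ^ 2 =
      (1 / 12 : ℝ) * ((∑ i, (a + b) i * w i) ^ 4 + (∑ i, (a - b) i * w i) ^ 4) +
        (-1 / 6 : ℝ) * ((∑ i, a i * w i) ^ 4 + (∑ i, b i * w i) ^ 4) := by
    intro w
    simp only [Pi.add_apply, Pi.sub_apply, add_mul, sub_mul, Finset.sum_add_distrib,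
      Finset.sum_sub_distrib]
    ring
  have i1 := ((hasAllMoments_linear v (a + b)).pow 4)
  have i2 := ((hasAllMoments_linear v (a - b)).pow 4)
  simp_rw [h]
  rw [integral_add ((i1.add i2).const_mul _).integrable
      (((ia.pow 4).add (ib.pow 4)).const_mul _).integrable, integral_const_mul,
    integral_const_mul, integral_add i1.integrable i2.integrable,
    integral_add (ia.pow 4).integrable (ib.pow 4).integrable, hp, hm, ha, hb]
  have hs1 : ∑ i, (v i : ℝ) * (a + b) i ^ 2 =
      ∑ i, v i * a i ^ 2 + 2 * ∑ i, v i * (a i * b i) + ∑ i, v i * b i ^ 2 := by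
    rw [Finset.mul_sum, ← Finset.sum_add_distrib, ← Finset.sum_add_distrib]
    exact Finset.sum_congr rfl fun i _ => by simp only [Pi.add_apply]; ring
  have hs2 : ∑ i, (v i : ℝ) * (a - b) i ^ 2 =
      ∑ i, v i * a i ^ 2 - 2 * ∑ i, v i * (a i * b i) + ∑ i, v i * b i ^ 2 := by
    rw [Finset.mul_sum, ← Finset.sum_sub_distrib, ← Finset.sum_add_distrib]
    exact Finset.sum_congr rfl fun i _ => by simp only [Pi.sub_apply]; ring
  rw [hs1, hs2]
  ring

lemma integral_linear_sq_mul_coord_sq [DecidableEq ι] (v : ι → ℝ≥0) (a : ι → ℝ) (j : ι) :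
    ∫ w, (∑ i, a i * w i) ^ 2 * w j ^ 2 ∂(diagGaussian v) =
      (∑ i, v i * a i ^ 2) * v j + 2 * (v j * a j) ^ 2 := by
  have h := integral_linear_sq_mul_linear_sq v a (Pi.single j 1)
  simpa [Pi.single_apply] using h

lemma integral_coord_sq (v : ι → ℝ≥0) (j : ι) :
    ∫ w, w j ^ 2 ∂(diagGaussian v) = v j := by
  classical
  have h := integral_linear_pow_two v (Pi.single j 1)
  simpa [Pi.single_apply] using h

lemma hasAllMoments_diag (v : ι → ℝ≥0) (e : ι → ℝ) :
    HasAllMoments (fun w : ι → ℝ => ∑ i, e i * w i ^ 2) (diagGaussian v) :=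
  HasAllMoments.sum _ fun i => ((hasAllMoments_coord v i).pow 2).const_mul (e i)

lemma integral_diag (v : ι → ℝ≥0) (e : ι → ℝ) :
    ∫ w, ∑ i, e i * w i ^ 2 ∂(diagGaussian v) = ∑ i, v i * e i := by
  rw [integral_finsetSum _ fun i _ =>
    (((hasAllMoments_coord v i).pow 2).const_mul (e i)).integrable]
  simp_rw [integral_const_mul, integral_coord_sq, mul_comm]

lemma integral_linear_sq_mul_diag (v : ι → ℝ≥0) (a e : ι → ℝ) :
    ∫ w, (∑ i, a i * w i) ^ 2 * ∑ i, e i * w i ^ 2 ∂(diagGaussian v) =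
      (∑ i, v i * a i ^ 2) * (∑ i, v i * e i) + 2 * ∑ i, v i ^ 2 * a i ^ 2 * e i := by
  classical
  have h : ∀ w : ι → ℝ, (∑ i, a i * w i) ^ 2 * ∑ j, e j * w j ^ 2 =
      ∑ j, e j * ((∑ i, a i * w i) ^ 2 * w j ^ 2) := fun w => by
    rw [Finset.mul_sum]
    exact Finset.sum_congr rfl fun i _ => by ring
  simp_rw [h]
  rw [integral_finsetSum _ fun i _ => ((((hasAllMoments_linear v a).pow 2).mul
    ((hasAllMoments_coord v i).pow 2)).const_mul (e i)).integrable]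
  simp_rw [integral_const_mul, integral_linear_sq_mul_coord_sq]
  rw [Finset.mul_sum, Finset.mul_sum, ← Finset.sum_add_distrib]
  exact Finset.sum_congr rfl fun i _ => by ring

lemma integral_diag_sq (v : ι → ℝ≥0) (e : ι → ℝ) :
    ∫ w, (∑ i, e i * w i ^ 2) ^ 2 ∂(diagGaussian v) =
      (∑ i, v i * e i) ^ 2 + 2 * ∑ i, v i ^ 2 * e i ^ 2 := by
  classical
  have h : ∀ w : ι → ℝ, (∑ i, e i * w i ^ 2) ^ 2 =
      ∑ j, e j * ((∑ i, (Pi.single j 1 : ι → ℝ) i * w i) ^ 2 * ∑ i, e i * w i ^ 2) := fun w => by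
    rw [sq, Finset.sum_mul]
    exact Finset.sum_congr rfl fun i _ => by simp [Pi.single_apply]; ring
  simp_rw [h]
  rw [integral_finsetSum _ fun i _ => ((((hasAllMoments_linear v _).pow 2).mul
    (hasAllMoments_diag v e)).const_mul (e i)).integrable]
  simp_rw [integral_const_mul, integral_linear_sq_mul_diag]
  rw [sq (∑ i, (v i : ℝ) * e i), Finset.sum_mul, Finset.mul_sum, ← Finset.sum_add_distrib]
  exact Finset.sum_congr rfl fun i _ => by simp [Pi.single_apply]; ring

lemma integral_quadratic_sq (v : ι → ℝ≥0) (α κ : ℝ) (b a e : ι → ℝ) :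
    ∫ w, (α + ∑ i, b i * w i + κ * (∑ i, a i * w i) ^ 2 + ∑ i, e i * w i ^ 2) ^ 2
        ∂(diagGaussian v) =
      (α + κ * ∑ i, v i * a i ^ 2 + ∑ i, v i * e i) ^ 2 + ∑ i, v i * b i ^ 2 +
        2 * κ ^ 2 * (∑ i, v i * a i ^ 2) ^ 2 + 4 * κ * ∑ i, v i ^ 2 * a i ^ 2 * e i +
        2 * ∑ i, v i ^ 2 * e i ^ 2 := by
  have iL := hasAllMoments_linear v b
  have iX := (hasAllMoments_linear v a).pow 2
  have iY := hasAllMoments_diag v e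
  have iodd := iL.mul (((HasAllMoments.const (2 * α)).add (iX.const_mul (2 * κ))).add
    (iY.const_mul 2))
  have i4 := (hasAllMoments_linear v a).pow 4
  have h : ∀ w : ι → ℝ,
      (α + ∑ i, b i * w i + κ * (∑ i, a i * w i) ^ 2 + ∑ i, e i * w i ^ 2) ^ 2 =
      α ^ 2 + (∑ i, b i * w i) ^ 2 + κ ^ 2 * (∑ i, a i * w i) ^ 4 + (∑ i, e i * w i ^ 2) ^ 2 +
      (2 * α * κ) * (∑ i, a i * w i) ^ 2 + (2 * α) * (∑ i, e i * w i ^ 2) +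
      (2 * κ) * ((∑ i, a i * w i) ^ 2 * ∑ i, e i * w i ^ 2) +
      (∑ i, b i * w i) * (2 * α + 2 * κ * (∑ i, a i * w i) ^ 2 + 2 * ∑ i, e i * w i ^ 2) :=
    fun w => by ring
  have j1 := (HasAllMoments.const (μ := diagGaussian v) (α ^ 2)).add (iL.pow 2)
  have j2 := j1.add (i4.const_mul (κ ^ 2))
  have j3 := j2.add (iY.pow 2)
  have j4 := j3.add (iX.const_mul (2 * α * κ))
  have j5 := j4.add (iY.const_mul (2 * α))
  have j6 := j5.add ((iX.mul iY).const_mul (2 * κ))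
  simp_rw [h]
  rw [integral_add j6.integrable iodd.integrable,
    integral_add j5.integrable ((iX.mul iY).const_mul (2 * κ)).integrable,
    integral_add j4.integrable (iY.const_mul (2 * α)).integrable,
    integral_add j3.integrable (iX.const_mul (2 * α * κ)).integrable,
    integral_add j2.integrable (iY.pow 2).integrable,
    integral_add j1.integrable (i4.const_mul (κ ^ 2)).integrable,
    integral_add (HasAllMoments.const _).integrable (iL.pow 2).integrable,
    integral_eq_zero_of_odd v (fun w => (∑ i, b i * w i) *
      (2 * α + 2 * κ * (∑ i, a i * w i) ^ 2 + 2 * ∑ i, e i * w i ^ 2))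
      (fun w => by simp [Finset.sum_neg_distrib])]
  simp_rw [integral_const_mul]
  rw [integral_linear_pow_two, integral_linear_pow_four, integral_diag_sq, integral_diag,
    integral_linear_sq_mul_diag, integral_linear_pow_two]
  simp
  ring

end DiagGaussian

section Density

variable {ι : Type*} [Fintype ι]

lemma diagGaussian_eq_withDensity (v : ι → ℝ≥0) (hv : ∀ i, v i ≠ 0) :
    diagGaussian v = (volume : Measure (ι → ℝ)).withDensity
      fun x => ENNReal.ofReal (∏ i, gaussianPDFReal 0 (v i) (x i)) := by
  refine Measure.pi_eq fun s hs => ?_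
  have hInt : Integrable (fun x : ι → ℝ => ∏ i, gaussianPDFReal 0 (v i) (x i))
      (volume.restrict (Set.univ.pi s)) :=
    (Integrable.fintype_prod (μ := fun _ : ι => (volume : Measure ℝ))
      fun i => integrable_gaussianPDFReal 0 (v i)).restrict
  rw [withDensity_apply _ (MeasurableSet.univ_pi hs), ← ofReal_integral_eq_lintegral_ofReal hInt
    (ae_of_all _ fun x => Finset.prod_nonneg fun i _ => gaussianPDFReal_nonneg _ _ _),
    volume_pi, Measure.restrict_pi_pi,
    integral_fintype_prod_eq_prod (f := fun i x => gaussianPDFReal 0 (v i) x),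
    ENNReal.ofReal_prod_of_nonneg
      fun i _ => integral_nonneg fun x => gaussianPDFReal_nonneg _ _ _]
  exact Finset.prod_congr rfl fun i _ => (gaussianReal_apply_eq_integral 0 (hv i) (s i)).symm

lemma integral_diagGaussian (v : ι → ℝ≥0) (hv : ∀ i, v i ≠ 0) (f : (ι → ℝ) → ℝ) :
    ∫ x, f x ∂(diagGaussian v) = ∫ x, (∏ i, gaussianPDFReal 0 (v i) (x i)) * f x := by
  rw [diagGaussian_eq_withDensity v hv, integral_withDensity_eq_integral_toReal_smul
    (by
      refine ENNReal.measurable_ofReal.comp (Finset.measurable_prod _ fun i _ => ?_)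
      exact (measurable_gaussianPDFReal 0 (v i)).comp (measurable_pi_apply i))
    (ae_of_all _ fun x => ENNReal.ofReal_lt_top)]
  refine integral_congr_ae (ae_of_all _ fun x => ?_)
  simp only [smul_eq_mul]
  rw [ENNReal.toReal_ofReal (Finset.prod_nonneg fun i _ => gaussianPDFReal_nonneg _ _ _)]

lemma gaussianPDFReal_mul_exp_neg_sq (v c : ℝ≥0) (x : ℝ) :
    gaussianPDFReal 0 v x * rexp (-(c * x ^ 2) / 2) =
      (√(1 + c * v))⁻¹ * gaussianPDFReal 0 (v / (1 + c * v)) x := by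
  have hp : (0 : ℝ) < 1 + c * v := by positivity
  rcases eq_or_ne v 0 with rfl | hv
  · simp
  have hv' : (v : ℝ) ≠ 0 := by exact_mod_cast hv
  have h1 : √(2 * π * (v / (1 + c * v))) = √(2 * π * v) / √(1 + c * v) := by
    rw [← mul_div_assoc, Real.sqrt_div (by positivity)]
  have h2 : √(1 + c * v : ℝ) ≠ 0 := (Real.sqrt_pos.2 hp).ne'
  simp only [gaussianPDFReal_def]
  push_cast
  rw [h1, inv_div, mul_assoc, ← Real.exp_add, ← mul_assoc, ← mul_div_assoc,
    inv_mul_cancel₀ h2, one_div]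
  congr 2
  field_simp
  ring

/-- Tilting a diagonal Gaussian by a Gaussian weight shrinks its variances. -/
lemma integral_exp_mul_diagGaussian (v c : ι → ℝ≥0) (hv : ∀ i, v i ≠ 0) (f : (ι → ℝ) → ℝ) :
    ∫ z, rexp (-(∑ i, c i * z i ^ 2) / 2) * f z ∂(diagGaussian v) =
      (∏ i, (√(1 + c i * v i))⁻¹) *
        ∫ z, f z ∂(diagGaussian fun i => v i / (1 + c i * v i)) := by
  have hv' : ∀ i, v i / (1 + c i * v i) ≠ 0 := fun i => div_ne_zero (hv i) (by positivity)
  rw [integral_diagGaussian v hv, integral_diagGaussian _ hv', ← integral_const_mul]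
  refine integral_congr_ae (ae_of_all _ fun z => ?_)
  simp only
  rw [← mul_assoc, ← mul_assoc, ← Finset.prod_mul_distrib]
  congr 1
  rw [← Finset.sum_neg_distrib, Finset.sum_div, Real.exp_sum, ← Finset.prod_mul_distrib]
  exact Finset.prod_congr rfl fun i _ => gaussianPDFReal_mul_exp_neg_sq _ _ _

end Density

section Conjugation

variable {d : ℕ} {U : Matrix (Fin d) (Fin d) ℝ}

lemma conj_diagonal_mul (hU : Uᵀ * U = 1) (D E : Fin d → ℝ) :
    (U * diagonal D * Uᵀ) * (U * diagonal E * Uᵀ) = U * diagonal (fun i => D i * E i) * Uᵀ := by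
  rw [← diagonal_mul_diagonal]
  calc _ = U * diagonal D * (Uᵀ * U) * diagonal E * Uᵀ := by simp only [Matrix.mul_assoc]
    _ = _ := by rw [hU]; simp only [Matrix.mul_assoc, Matrix.one_mul]

lemma one_eq_conj_diagonal (hU : Uᵀ * U = 1) : (1 : Matrix (Fin d) (Fin d) ℝ) =
    U * diagonal (fun _ => (1 : ℝ)) * Uᵀ := by
  rw [diagonal_one, Matrix.mul_one, mul_eq_one_comm.1 hU]

lemma conj_diagonal_add (D E : Fin d → ℝ) :
    (U * diagonal D * Uᵀ) + (U * diagonal E * Uᵀ) = U * diagonal (fun i => D i + E i) * Uᵀ := by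
  rw [← diagonal_add, Matrix.mul_add, Matrix.add_mul]

lemma smul_conj_diagonal (c : ℝ) (D : Fin d → ℝ) :
    c • (U * diagonal D * Uᵀ) = U * diagonal (fun i => c * D i) * Uᵀ := by
  have : diagonal (fun i => c * D i) = c • diagonal D := by
    rw [← diagonal_smul]; rfl
  rw [this, Matrix.mul_smul, Matrix.smul_mul]

lemma inv_conj_diagonal (hU : Uᵀ * U = 1) (D : Fin d → ℝ) (hD : ∀ i, D i ≠ 0) :
    (U * diagonal D * Uᵀ)⁻¹ = U * diagonal (fun i => (D i)⁻¹) * Uᵀ := by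
  apply Matrix.inv_eq_right_inv
  rw [conj_diagonal_mul hU, one_eq_conj_diagonal hU]
  simp only [mul_inv_cancel₀ (hD _)]

lemma trace_conj_diagonal (hU : Uᵀ * U = 1) (D : Fin d → ℝ) :
    (U * diagonal D * Uᵀ).trace = ∑ i, D i := by
  rw [Matrix.trace_mul_comm, ← Matrix.mul_assoc, hU, Matrix.one_mul, trace_diagonal]

lemma det_conj_diagonal (hU : Uᵀ * U = 1) (D : Fin d → ℝ) :
    (U * diagonal D * Uᵀ).det = ∏ i, D i := by
  have h : U.det * U.det = 1 := by
    have := congrArg Matrix.det hU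
    rwa [det_mul, det_transpose, det_one] at this
  rw [det_mul, det_mul, det_transpose, det_diagonal]
  linear_combination (∏ i, D i) * h

lemma dotProduct_conj_diagonal (hU : Uᵀ * U = 1) (D z w : Fin d → ℝ) :
    (U *ᵥ z) ⬝ᵥ ((U * diagonal D * Uᵀ) *ᵥ (U *ᵥ w)) = ∑ i, D i * z i * w i := by
  rw [mulVec_mulVec, Matrix.mul_assoc, hU, Matrix.mul_one, ← mulVec_mulVec,
    dotProduct_comm, dotProduct_mulVec, ← mulVec_transpose, mulVec_mulVec, hU, one_mulVec]
  simp only [dotProduct, mulVec_diagonal]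
  exact Finset.sum_congr rfl fun i _ => by ring

lemma gaussN_density_conj (hU : Uᵀ * U = 1) (v : Fin d → ℝ≥0) (hv : ∀ i, v i ≠ 0)
    (z : Fin d → ℝ) :
    (2 * π) ^ (-(d : ℝ) / 2) * (U * diagonal (fun i => (v i : ℝ)) * Uᵀ).det ^ (-(1 : ℝ) / 2) *
      rexp (-((U *ᵥ z) ⬝ᵥ ((U * diagonal (fun i => (v i : ℝ)) * Uᵀ)⁻¹ *ᵥ (U *ᵥ z))) / 2) =
      ∏ i, gaussianPDFReal 0 (v i) (z i) := by
  rw [det_conj_diagonal hU, inv_conj_diagonal hU _ (fun i => by exact_mod_cast hv i),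
    dotProduct_conj_diagonal hU]
  simp only [gaussianPDFReal_def]
  rw [Finset.prod_mul_distrib, ← Real.exp_sum]
  congr 1
  · have h : ∀ i, (√(2 * π * v i))⁻¹ = (2 * π) ^ (-(1 : ℝ) / 2) * (v i : ℝ) ^ (-(1 : ℝ) / 2) := by
      intro i
      rw [Real.sqrt_eq_rpow, ← Real.rpow_neg (by positivity),
        Real.mul_rpow (by positivity) (by positivity)]
      norm_num
    simp_rw [h]
    rw [Finset.prod_mul_distrib, Finset.prod_const, Finset.card_univ, Fintype.card_fin,
      Real.finsetProd_rpow _ _ (fun i _ => NNReal.coe_nonneg _), ← Real.rpow_natCast,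
      ← Real.rpow_mul (by positivity)]
    congr 2
    ring
  · congr 1
    rw [← Finset.sum_neg_distrib, Finset.sum_div]
    refine Finset.sum_congr rfl fun i _ => ?_
    have : (v i : ℝ) ≠ 0 := by exact_mod_cast hv i
    field_simp
    ring

lemma integral_gaussN_conj (hU : Uᵀ * U = 1) (v : Fin d → ℝ≥0) (hv : ∀ i, v i ≠ 0)
    (m : Fin d → ℝ) (f : (Fin d → ℝ) → ℝ) :
    ∫ x, f x ∂(gaussN m (U * diagonal (fun i => (v i : ℝ)) * Uᵀ)) =
      ∫ z, f (m + U *ᵥ z) ∂(diagGaussian v) := by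
  have hdet : |U.det⁻¹| = 1 := by
    have h : U.det * U.det = 1 := by
      have := congrArg Matrix.det hU
      rwa [det_mul, det_transpose, det_one] at this
    rcases mul_self_eq_one_iff.1 h with h | h <;> simp [h]
  have hdet0 : U.det ≠ 0 := by
    intro h
    simp [h] at hdet
  have hmp : MeasurePreserving (fun z : Fin d → ℝ => m + U *ᵥ z) volume volume := by
    have h1 : MeasurePreserving (fun z : Fin d → ℝ => U *ᵥ z) volume volume := by
      refine ⟨by fun_prop, ?_⟩
      have := Real.map_matrix_volume_pi_eq_smul_volume_pi hdet0
      rw [hdet, ENNReal.ofReal_one, one_smul] at this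
      exact this
    exact (measurePreserving_add_left volume m).comp h1
  have hemb : MeasurableEmbedding (fun z : Fin d → ℝ => m + U *ᵥ z) := by
    refine Continuous.measurableEmbedding (by fun_prop) fun z w h => ?_
    have h' : U *ᵥ z = U *ᵥ w := add_left_cancel h
    have := congrArg (fun u => Uᵀ *ᵥ u) h'
    simpa [mulVec_mulVec, hU] using this
  rw [integral_diagGaussian v hv, gaussN, integral_withDensity_eq_integral_toReal_smul
    (by
      refine ENNReal.measurable_ofReal.comp (Continuous.measurable ?_)
      unfold dotProduct
      fun_prop)
    (ae_of_all _ fun x => ENNReal.ofReal_lt_top), ← hmp.integral_comp hemb]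
  refine integral_congr_ae (ae_of_all _ fun z => ?_)
  simp only [add_sub_cancel_left, smul_eq_mul]
  rw [gaussN_density_conj hU v hv, ENNReal.toReal_ofReal
    (Finset.prod_nonneg fun i _ => gaussianPDFReal_nonneg _ _ _)]

end Conjugation

section Coordinates

variable {d : ℕ} {U : Matrix (Fin d) (Fin d) ℝ}

lemma trace_rankOne_expansion (W S : Matrix (Fin d) (Fin d) ℝ) (c : ℝ) (x y : Fin d → ℝ) :
    (W * (c • vecMulVec x x * W - 1) * (vecMulVec y y - S)).trace =
      c * ((x ⬝ᵥ (W *ᵥ y)) * (y ⬝ᵥ (W *ᵥ x)) - x ⬝ᵥ ((W * S * W) *ᵥ x)) -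
        (y ⬝ᵥ (W *ᵥ y) - (W * S).trace) := by
  have h0 : W * vecMulVec x x * W = vecMulVec (W *ᵥ x) (x ᵥ* W) := by
    rw [mul_vecMulVec, vecMulVec_mul]
  have h1 : (W * vecMulVec x x * W * vecMulVec y y).trace =
      (x ⬝ᵥ (W *ᵥ y)) * (y ⬝ᵥ (W *ᵥ x)) := by
    rw [h0, vecMulVec_mul, vecMul_vecMulVec, trace_vecMulVec, dotProduct_smul,
      smul_eq_mul, dotProduct_mulVec, dotProduct_comm y]
  have h2 : (W * vecMulVec x x * W * S).trace = x ⬝ᵥ ((W * S * W) *ᵥ x) := by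
    rw [h0, vecMulVec_mul, trace_vecMulVec, dotProduct_comm, vecMul_vecMul, dotProduct_mulVec,
      vecMul_vecMul, ← dotProduct_mulVec]
  have h3 : (W * vecMulVec y y).trace = y ⬝ᵥ (W *ᵥ y) := by
    rw [mul_vecMulVec, trace_vecMulVec, dotProduct_comm]
  have h4 : W * (c • vecMulVec x x * W - 1) * (vecMulVec y y - S) =
      c • (W * vecMulVec x x * W * vecMulVec y y - W * vecMulVec x x * W * S) -
        (W * vecMulVec y y - W * S) := by
    simp only [Matrix.mul_sub, Matrix.sub_mul, Matrix.smul_mul, Matrix.mul_smul, Matrix.mul_one,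
      smul_sub, Matrix.mul_assoc]
    abel
  rw [h4, trace_sub, trace_smul, trace_sub, trace_sub, h1, h2, h3, smul_eq_mul]

lemma Vm_conj (hU : Uᵀ * U = 1) (σ : ℝ) (v : Fin d → ℝ) :
    Vm σ (U * diagonal v * Uᵀ) = U * diagonal (fun i => 1 + 2 * σ * v i) * Uᵀ := by
  rw [Vm, smul_conj_diagonal, one_eq_conj_diagonal hU, conj_diagonal_add]

lemma T2_conj (hU : Uᵀ * U = 1) (σ : ℝ) (hσ : 0 < σ) (m : Fin d → ℝ) (v : Fin d → ℝ≥0)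
    (K : Fin d → ℝ) (hK : ∀ i, K i = (1 + 2 * σ * v i)⁻¹) (z w : Fin d → ℝ) :
    T2 σ m (U * diagonal (fun i => (v i : ℝ)) * Uᵀ) (m + U *ᵥ z) (m + U *ᵥ w) =
      (∏ i, (1 + 2 * σ * v i)) ^ (-(1 : ℝ) / 2) * rexp (-σ * ∑ i, K i * z i ^ 2) *
        ((1 - 2 * σ ^ 2 * ∑ i, v i * (K i * z i) ^ 2 + σ * ∑ i, v i * K i) +
          ∑ i, (2 * σ * (K i * z i)) * w i + 2 * σ ^ 2 * (∑ i, (K i * z i) * w i) ^ 2 +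
          ∑ i, (-σ * K i) * w i ^ 2) := by
  have hV : ∀ i, (1 + 2 * σ * v i : ℝ) ≠ 0 := fun i => by positivity
  rw [T2, Vm_conj hU, inv_conj_diagonal hU _ hV, det_conj_diagonal hU]
  simp_rw [← hK]
  simp only [Bm, sub_add_cancel, add_sub_cancel_left]
  rw [trace_rankOne_expansion, conj_diagonal_mul hU, conj_diagonal_mul hU,
    trace_conj_diagonal hU]
  simp only [dotProduct_conj_diagonal hU]
  have e1 : ∑ i, K i * z i * z i = ∑ i, K i * z i ^ 2 :=
    Finset.sum_congr rfl fun i _ => by ring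
  have e2 : ∑ i, K i * w i * z i = ∑ i, K i * z i * w i :=
    Finset.sum_congr rfl fun i _ => by ring
  have e3 : ∑ i, K i * v i * K i * z i * z i = ∑ i, v i * (K i * z i) ^ 2 :=
    Finset.sum_congr rfl fun i _ => by ring
  have e4 : ∑ i, K i * (v i : ℝ) = ∑ i, v i * K i :=
    Finset.sum_congr rfl fun i _ => by ring
  have e5 : ∑ i, (2 * σ * (K i * z i)) * w i = 2 * σ * ∑ i, K i * z i * w i := by
    rw [Finset.mul_sum]
    exact Finset.sum_congr rfl fun i _ => by ring
  have e6 : ∑ i, (-σ * K i) * w i ^ 2 = -σ * ∑ i, K i * w i * w i := by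
    rw [Finset.mul_sum]
    exact Finset.sum_congr rfl fun i _ => by ring
  rw [e1, e2, e3, e4, e5, e6]
  ring

lemma integrable_T2_conj_sq (hU : Uᵀ * U = 1) (σ : ℝ) (hσ : 0 < σ) (m : Fin d → ℝ)
    (v : Fin d → ℝ≥0) :
    Integrable (fun q : (Fin d → ℝ) × (Fin d → ℝ) =>
      T2 σ m (U * diagonal (fun i => (v i : ℝ)) * Uᵀ) (m + U *ᵥ q.2) (m + U *ᵥ q.1) ^ 2)
      ((diagGaussian v).prod (diagGaussian v)) := by
  simp_rw [T2_conj hU σ hσ m v _ (fun i => rfl)]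
  have hw := fun i => (hasAllMoments_coord v i).comp
    (measurePreserving_fst (μ := diagGaussian v) (ν := diagGaussian v))
  have hz := fun i => (hasAllMoments_coord v i).comp
    (measurePreserving_snd (μ := diagGaussian v) (ν := diagGaussian v))
  have he : HasAllMoments (fun q : (Fin d → ℝ) × (Fin d → ℝ) =>
      rexp (-σ * ∑ i, (1 + 2 * σ * v i : ℝ)⁻¹ * q.2 i ^ 2))
      ((diagGaussian v).prod (diagGaussian v)) := by
    refine HasAllMoments.of_bound (Continuous.aestronglyMeasurable (by fun_prop)) 1 fun q => ?_
    rw [Real.norm_eq_abs, abs_of_pos (Real.exp_pos _), Real.exp_le_one_iff]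
    have : 0 ≤ ∑ i, (1 + 2 * σ * v i : ℝ)⁻¹ * q.2 i ^ 2 :=
      Finset.sum_nonneg fun i _ => by positivity
    nlinarith
  have hKz := fun i => (hz i).const_mul (1 + 2 * σ * v i : ℝ)⁻¹
  have h1 := HasAllMoments.sum Finset.univ fun i => ((hKz i).pow 2).const_mul (v i : ℝ)
  have h2 := HasAllMoments.sum Finset.univ fun i => ((hKz i).const_mul (2 * σ)).mul (hw i)
  have h3 := HasAllMoments.sum Finset.univ fun i => (hKz i).mul (hw i)
  have h4 := HasAllMoments.sum Finset.univ fun i =>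
    ((hw i).pow 2).const_mul (-σ * (1 + 2 * σ * v i : ℝ)⁻¹)
  have h0 := (HasAllMoments.const (μ := (diagGaussian v).prod (diagGaussian v))
    (1 + σ * ∑ i, v i * (1 + 2 * σ * v i : ℝ)⁻¹)).add (h1.const_mul (-(2 * σ ^ 2)))
  have h := (((he.const_mul ((∏ i, (1 + 2 * σ * v i : ℝ)) ^ (-(1 : ℝ) / 2))).mul
    (((h0.add h2).add ((h3.pow 2).const_mul (2 * σ ^ 2))).add h4)).pow 2).integrable
  refine h.congr (ae_of_all _ fun q => ?_)
  ring

lemma conj_diagonal_sq (hU : Uᵀ * U = 1) (D : Fin d → ℝ) :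
    (U * diagonal D * Uᵀ) ^ 2 = U * diagonal (fun i => D i ^ 2) * Uᵀ := by
  simp_rw [pow_two]
  exact conj_diagonal_mul hU D D

lemma integral_T2_conj_sq (hU : Uᵀ * U = 1) (σ : ℝ) (hσ : 0 < σ) (m : Fin d → ℝ)
    (v : Fin d → ℝ≥0) (K : Fin d → ℝ) (hK : ∀ i, K i = (1 + 2 * σ * v i)⁻¹) (z : Fin d → ℝ) :
    ∫ w, T2 σ m (U * diagonal (fun i => (v i : ℝ)) * Uᵀ) (m + U *ᵥ z) (m + U *ᵥ w) ^ 2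
        ∂(diagGaussian v) =
      ((∏ i, (1 + 2 * σ * v i : ℝ)) ^ (-(1 : ℝ) / 2)) ^ 2 *
        (rexp (-(∑ i, 4 * σ * K i * z i ^ 2) / 2) *
          (1 + 2 * σ ^ 2 * ∑ i, v i ^ 2 * K i ^ 2 +
            ∑ i, (4 * σ ^ 2 * v i * K i ^ 2 - 8 * σ ^ 3 * v i ^ 2 * K i ^ 3) * z i ^ 2 +
            8 * σ ^ 4 * (∑ i, v i * K i ^ 2 * z i ^ 2) ^ 2)) := by
  simp_rw [T2_conj hU σ hσ m v K hK, mul_pow]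
  rw [integral_const_mul, integral_quadratic_sq, mul_assoc]
  congr 1
  have hexp : rexp (-σ * ∑ i, K i * z i ^ 2) ^ 2 =
      rexp (-(∑ i, 4 * σ * K i * z i ^ 2) / 2) := by
    rw [← Real.exp_nat_mul]
    have : ∑ i, 4 * σ * K i * z i ^ 2 = 4 * σ * ∑ i, K i * z i ^ 2 := by
      rw [Finset.mul_sum]
      exact Finset.sum_congr rfl fun i _ => by ring
    rw [this]
    congr 1
    push_cast
    ring
  have h0 : ∑ i, (v i : ℝ) * (-σ * K i) = -σ * ∑ i, v i * K i := by
    rw [Finset.mul_sum]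
    exact Finset.sum_congr rfl fun i _ => by ring
  have h1 : ∑ i, (v i : ℝ) * (K i * z i) ^ 2 = ∑ i, v i * K i ^ 2 * z i ^ 2 :=
    Finset.sum_congr rfl fun i _ => by ring
  have h2 : ∑ i, (v i : ℝ) * (2 * σ * (K i * z i)) ^ 2 +
      4 * (2 * σ ^ 2) * ∑ i, (v i : ℝ) ^ 2 * (K i * z i) ^ 2 * (-σ * K i) =
      ∑ i, (4 * σ ^ 2 * v i * K i ^ 2 - 8 * σ ^ 3 * v i ^ 2 * K i ^ 3) * z i ^ 2 := by
    rw [Finset.mul_sum, ← Finset.sum_add_distrib]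
    exact Finset.sum_congr rfl fun i _ => by ring
  have h3 : ∑ i, (v i : ℝ) ^ 2 * (-σ * K i) ^ 2 = σ ^ 2 * ∑ i, v i ^ 2 * K i ^ 2 := by
    rw [Finset.mul_sum]
    exact Finset.sum_congr rfl fun i _ => by ring
  simp_rw [← mul_pow] at h0 h1 h2 h3 ⊢
  rw [hexp, ← h2, h0, h1, h3]
  ring

lemma exists_conj_diagonal_eq {S : Matrix (Fin d) (Fin d) ℝ} (hS : S.PosDef) :
    ∃ (U : Matrix (Fin d) (Fin d) ℝ) (v : Fin d → ℝ≥0), Uᵀ * U = 1 ∧ (∀ i, v i ≠ 0) ∧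
      S = U * diagonal (fun i => (v i : ℝ)) * Uᵀ := by
  refine ⟨hS.1.eigenvectorUnitary, fun i => ⟨hS.1.eigenvalues i, (hS.eigenvalues_pos i).le⟩,
    ?_, fun i h => (hS.eigenvalues_pos i).ne' (congrArg NNReal.toReal h), ?_⟩
  · have := Unitary.coe_star_mul_self hS.1.eigenvectorUnitary
    rwa [star_eq_conjTranspose, conjTranspose_eq_transpose_of_trivial] at this
  · conv_lhs => rw [hS.1.spectral_theorem, Unitary.conjStarAlgAut_apply, star_eq_conjTranspose,
      conjTranspose_eq_transpose_of_trivial]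
    rfl

lemma prod_rpow_sq_mul_prod_inv_sqrt {ι : Type*} [Fintype ι] (a b : ι → ℝ) (ha : ∀ i, 0 < a i)
    (hb : ∀ i, 0 < b i) :
    ((∏ i, a i) ^ (-(1 : ℝ) / 2)) ^ 2 * ∏ i, (√(b i / a i))⁻¹ =
      (∏ i, a i) ^ (-(1 : ℝ) / 2) * (∏ i, b i) ^ (-(1 : ℝ) / 2) := by
  have h : ∀ x : ℝ, 0 < x → x ^ (-(1 : ℝ) / 2) = (√x)⁻¹ := fun x hx => by
    rw [Real.sqrt_eq_rpow, ← Real.rpow_neg hx.le]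
    norm_num
  rw [Finset.prod_inv_distrib, ← Real.sqrt_prod _ fun i _ => (div_pos (hb i) (ha i)).le,
    Finset.prod_div_distrib, h _ (Finset.prod_pos fun i _ => ha i),
    h _ (Finset.prod_pos fun i _ => hb i), Real.sqrt_div (Finset.prod_nonneg fun i _ => (hb i).le)]
  have := (Real.sqrt_pos.2 (Finset.prod_pos fun i (_ : i ∈ Finset.univ) => ha i)).ne'
  field_simp

end Coordinates

/-- Explicit formula for `∫∫ T₂(x,y)² dN(m₀,Σ₀)(x) dN(m₀,Σ₀)(y)`. -/
theorem T2_square_double_integral {d : ℕ} (hd : 1 ≤ d) (σ : ℝ) (hσ : 0 < σ)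
    (m₀ : Fin d → ℝ) (S : Matrix (Fin d) (Fin d) ℝ) (hS : S.PosDef) :
    ∫ y, (∫ x, (T2 σ m₀ S x y) ^ 2 ∂(gaussN m₀ S)) ∂(gaussN m₀ S) =
      (Vm σ S).det ^ (-(1 : ℝ) / 2) * (Vm σ S + (4 * σ) • S).det ^ (-(1 : ℝ) / 2) *
        (1 + (1 / 2) * σ ^ 2 * ((Vm σ S)⁻¹ * S).trace ^ 2
           + σ ^ 2 * (((Vm σ S)⁻¹ * S) ^ 2).trace
           + (1 / 2) * σ ^ 2 * ((Vm σ S + (4 * σ) • S)⁻¹ * S).trace ^ 2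
           + σ ^ 2 * (((Vm σ S + (4 * σ) • S)⁻¹ * S) ^ 2).trace
           + σ * ((Vm σ S)⁻¹ * S).trace
           - σ * ((Vm σ S + (4 * σ) • S)⁻¹ * S).trace
           - σ ^ 2 * ((Vm σ S)⁻¹ * S).trace * ((Vm σ S + (4 * σ) • S)⁻¹ * S).trace) := by
  obtain ⟨U, v, hU, hv, rfl⟩ := exists_conj_diagonal_eq hS
  have hV : ∀ i, (0 : ℝ) < 1 + 2 * σ * v i := fun i => by positivity
  have hW : ∀ i, (0 : ℝ) < 1 + 2 * σ * v i + 4 * σ * v i := fun i => by positivity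
  set K : Fin d → ℝ := fun i => (1 + 2 * σ * v i)⁻¹ with hK
  have hK0 : ∀ i, 0 < K i := fun i => inv_pos.2 (hV i)
  set c : Fin d → ℝ≥0 := fun i => (4 * σ * K i).toNNReal
  have hc : ∀ i, (c i : ℝ) = 4 * σ * K i := fun i =>
    Real.coe_toNNReal _ (by have := hK0 i; positivity)
  set p : Fin d → ℝ := fun i => (1 + 2 * σ * v i)⁻¹ * v i
  set k : Fin d → ℝ := fun i => (1 + 2 * σ * v i + 4 * σ * v i)⁻¹ * v i
  set v' : Fin d → ℝ≥0 := fun i => v i / (1 + c i * v i)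
  have hcv : ∀ i, (1 + c i * v i : ℝ) =
      (1 + 2 * σ * v i + 4 * σ * v i) / (1 + 2 * σ * v i) := fun i => by
    have := (hV i).ne'
    rw [hc, hK]
    field_simp
  have hv' : ∀ i, (v' i : ℝ) = v i * (1 + 2 * σ * v i) / (1 + 2 * σ * v i + 4 * σ * v i) :=
    fun i => by
      simp only [v', NNReal.coe_div, NNReal.coe_add, NNReal.coe_one, NNReal.coe_mul]
      rw [hcv, div_div_eq_mul_div]
  have hh : ∀ i, v' i * (v i * K i ^ 2) = (p i - k i) / (4 * σ) := fun i => by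
    have h1 := (hV i).ne'
    have h2 := (hW i).ne'
    rw [hv']
    simp only [hK, p, k]
    field_simp
    ring
  have hg : ∀ i, v' i * (4 * σ ^ 2 * v i * K i ^ 2 - 8 * σ ^ 3 * v i ^ 2 * K i ^ 3) =
      σ * p i - σ * k i - 2 * σ ^ 2 * p i ^ 2 + 2 * σ ^ 2 * (p i * k i) := fun i => by
    have h : v' i * (4 * σ ^ 2 * v i * K i ^ 2 - 8 * σ ^ 3 * v i ^ 2 * K i ^ 3) =
      4 * σ ^ 2 * (v' i * (v i * K i ^ 2)) * (1 - 2 * σ * p i) := by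
      simp only [hK, p]
      ring
    rw [h, hh]
    field_simp
    ring
  have hm1 := hasAllMoments_diag v' fun i =>
    4 * σ ^ 2 * v i * K i ^ 2 - 8 * σ ^ 3 * v i ^ 2 * K i ^ 3
  have hm2 := (hasAllMoments_diag v' fun i => v i * K i ^ 2).pow 2
  have hm0 := HasAllMoments.const (μ := diagGaussian v')
    (1 + 2 * σ ^ 2 * ∑ i, (v i : ℝ) ^ 2 * K i ^ 2)
  rw [integral_gaussN_conj hU v hv]
  simp_rw [integral_gaussN_conj hU v hv]
  rw [integral_integral_swap (integrable_T2_conj_sq hU σ hσ m₀ v)]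
  simp_rw [integral_T2_conj_sq hU σ hσ m₀ v K (fun i => rfl), ← hc]
  rw [integral_const_mul, integral_exp_mul_diagGaussian v c hv,
    integral_add (hm0.add hm1).integrable (hm2.const_mul _).integrable,
    integral_add hm0.integrable hm1.integrable, integral_const_mul, integral_diag,
    integral_diag_sq, ← mul_assoc]
  simp_rw [hcv]
  rw [prod_rpow_sq_mul_prod_inv_sqrt _ _ hV hW, Vm_conj hU, smul_conj_diagonal, conj_diagonal_add,
    inv_conj_diagonal hU _ fun i => (hV i).ne', inv_conj_diagonal hU _ fun i => (hW i).ne',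
    det_conj_diagonal hU, det_conj_diagonal hU, conj_diagonal_mul hU, conj_diagonal_mul hU,
    conj_diagonal_sq hU, conj_diagonal_sq hU]
  simp only [trace_conj_diagonal hU, integral_const, probReal_univ, one_smul]
  congr 1
  have hp : ∀ i, (1 + 2 * σ * v i : ℝ)⁻¹ * v i = p i := fun _ => rfl
  have hk : ∀ i, (1 + 2 * σ * v i + 4 * σ * v i : ℝ)⁻¹ * v i = k i := fun _ => rfl
  have hpv : ∑ i, (v i : ℝ) ^ 2 * K i ^ 2 = ∑ i, p i ^ 2 :=
    Finset.sum_congr rfl fun i _ => by simp only [hK, p]; ring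
  have hsq : ∀ i, (v' i : ℝ) ^ 2 * (v i * K i ^ 2) ^ 2 =
      (p i ^ 2 - 2 * (p i * k i) + k i ^ 2) / (16 * σ ^ 2) := fun i => by
    rw [← mul_pow, hh]
    field_simp
    ring
  simp_rw [hp, hk, hg, hh, hsq]
  rw [hpv, ← Finset.sum_div, ← Finset.sum_div]
  simp only [Finset.sum_add_distrib, Finset.sum_sub_distrib, ← Finset.mul_sum]
  field_simp
  ring
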